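/- For all δ>0 there exists Δ₀=Δ₀(δ) such that for every finite graph G=(V,E) with maximum degree Δ≥Δ₀ and every 0<λ<(1−δ)·λ_c(Δ): the oriented-edge belief-propagation operator H has a unique fixed point ω*, and for any initial value ω⁰ ∈ [0,1]^{Ē} and every integer i≥0, the i-th iterate ω^i = H^i(ω⁰) satisfies ‖ω^i − ω*‖_∞ ≤ 3·(1−δ/6)^i. -/

import Mathlib

open scoped BigOperators

noncomputable section

namespace HardCore

/-- The critical fugacity `λ_c(Δ) = (Δ-1)^(Δ-1) / (Δ-2)^Δ`. -/
def lambdaC (D : ℕ) : ℝ := ((D : ℝ) - 1) ^ (D - 1) / ((D : ℝ) - 2) ^ D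

variable {V : Type} [Fintype V] [DecidableEq V]

/-- The set `Ē` of orientations of edges of `G`. -/
abbrev DEdge (G : SimpleGraph V) : Type := {e : V × V // G.Adj e.1 e.2}

/-- The oriented-edge belief-propagation operator
`H(ω)(v,p) = ∏_{u ∈ N(v)\{p}} 1/(1 + λ·ω(u,v))`. -/
def bpH (G : SimpleGraph V) [DecidableRel G.Adj] (lam : ℝ) (ω : DEdge G → ℝ) :
    DEdge G → ℝ :=
  fun e => ∏ u ∈ ((G.neighborFinset e.1.1).erase e.1.2).attach,
    (1 + lam * ω ⟨(u.1, e.1.1),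
      ((G.mem_neighborFinset e.1.1 u.1).mp (Finset.mem_of_mem_erase u.2)).symm⟩)⁻¹

end HardCore

open HardCore

/-- Cauchy-Schwarz together with `x * exp (-x) ≤ exp (-1)` bounds the `ℓ¹`-norm of the gradient of
`q ↦ ∏ (1 + lam * q u ^ 2) ^ (-1 / 2)`. -/
lemma exp_neg_half_sum_log_mul_sum_le {ι : Type*} (s : Finset ι) (q : ι → ℝ) {lam K d : ℝ}
    (hlam : 0 < lam) (hK : 0 ≤ K) (hs : (s.card : ℝ) ≤ d) (hd : lam * d ≤ Real.exp 1 * K ^ 2) :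
    Real.exp (-(∑ u ∈ s, Real.log (1 + lam * q u ^ 2)) / 2) *
      ∑ u ∈ s, lam * |q u| / (1 + lam * q u ^ 2) ≤ K := by
  set S := ∑ u ∈ s, Real.log (1 + lam * q u ^ 2) with hS
  have hpos (u : ι) : 0 < 1 + lam * q u ^ 2 := by positivity
  have hcs : (∑ u ∈ s, lam * |q u| / (1 + lam * q u ^ 2)) ^ 2 ≤ d * (lam * S) := by
    calc _ ≤ (s.card : ℝ) * ∑ u ∈ s, (lam * |q u| / (1 + lam * q u ^ 2)) ^ 2 :=
          sq_sum_le_card_mul_sum_sq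
      _ ≤ d * (lam * S) := by
          refine mul_le_mul hs ?_ (Finset.sum_nonneg fun _ _ => sq_nonneg _)
            (le_trans (Nat.cast_nonneg _) hs)
          rw [hS, Finset.mul_sum]
          refine Finset.sum_le_sum fun u _ => ?_
          have h1 := Real.one_sub_inv_le_log_of_pos (hpos u)
          refine le_trans ?_ (mul_le_mul_of_nonneg_left h1 hlam.le)
          have h2 : 1 - (1 + lam * q u ^ 2)⁻¹ = lam * q u ^ 2 / (1 + lam * q u ^ 2) := by
            field_simp [(hpos u).ne']
            ring
          rw [h2, div_pow, mul_pow, sq_abs, ← mul_div_assoc, div_le_div_iff₀ (by positivity) (hpos u)]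
          have h3 : 0 ≤ lam * q u ^ 2 := by positivity
          have h4 : 0 ≤ lam ^ 2 * q u ^ 2 * (1 + lam * q u ^ 2) * (lam * q u ^ 2) := by positivity
          nlinarith
  have hS0 : S ≤ Real.exp (S - 1) := by linarith [Real.add_one_le_exp (S - 1)]
  have hSnn : 0 ≤ S := Finset.sum_nonneg fun u _ =>
    Real.log_nonneg (le_add_of_nonneg_right (by positivity))
  refine abs_le_of_sq_le_sq' ?_ hK |>.2
  rw [mul_pow, ← Real.exp_nat_mul]
  have he : ((2 : ℕ) : ℝ) * (-S / 2) = -S := by push_cast; ring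
  rw [he]
  have hd0 : 0 ≤ lam * d := mul_nonneg hlam.le (le_trans (Nat.cast_nonneg _) hs)
  calc Real.exp (-S) * (∑ u ∈ s, lam * |q u| / (1 + lam * q u ^ 2)) ^ 2
      ≤ Real.exp (-S) * (d * (lam * S)) := by gcongr
    _ = Real.exp (-S) * (lam * d * S) := by ring
    _ ≤ Real.exp (-S) * (Real.exp 1 * K ^ 2 * Real.exp (S - 1)) := by gcongr
    _ = (Real.exp (-S) * Real.exp 1 * Real.exp (S - 1)) * K ^ 2 := by ring
    _ = K ^ 2 := by
      rw [← Real.exp_add, ← Real.exp_add, show -S + 1 + (S - 1) = 0 by ring, Real.exp_zero, one_mul]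

lemma sqrt_prod_inv_eq_exp {ι : Type*} (s : Finset ι) (q : ι → ℝ) {lam : ℝ} (hlam : 0 < lam) :
    √(∏ u ∈ s, (1 + lam * q u ^ 2)⁻¹) =
      Real.exp (-(∑ u ∈ s, Real.log (1 + lam * q u ^ 2)) / 2) := by
  have hpos (u : ι) : 0 < 1 + lam * q u ^ 2 := by positivity
  rw [Real.exp_half, ← Finset.sum_neg_distrib, Real.exp_sum]
  congr 1
  refine Finset.prod_congr rfl fun u _ => ?_
  rw [Real.exp_neg, Real.exp_log (hpos u)]

lemma abs_sqrt_prod_inv_sub_le {ι : Type*} (s : Finset ι) (q r : ι → ℝ) {lam K d B : ℝ}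
    (hlam : 0 < lam) (hK : 0 ≤ K) (hs : (s.card : ℝ) ≤ d) (hd : lam * d ≤ Real.exp 1 * K ^ 2)
    (hB0 : 0 ≤ B) (hB : ∀ u, |r u - q u| ≤ B) :
    |√(∏ u ∈ s, (1 + lam * r u ^ 2)⁻¹) - √(∏ u ∈ s, (1 + lam * q u ^ 2)⁻¹)| ≤ K * B := by
  rw [sqrt_prod_inv_eq_exp s r hlam, sqrt_prod_inv_eq_exp s q hlam]
  set p : ℝ → ι → ℝ := fun t u => q u + t * (r u - q u) with hp
  set g : ℝ → ℝ := fun t => Real.exp (-(∑ u ∈ s, Real.log (1 + lam * p t u ^ 2)) / 2) with hg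
  have hpos (t : ℝ) (u : ι) : 0 < 1 + lam * p t u ^ 2 := by positivity
  have hder (t : ℝ) : HasDerivAt g
      (g t * (-(∑ u ∈ s, lam * (2 * p t u * (r u - q u)) / (1 + lam * p t u ^ 2)) / 2)) t := by
    refine HasDerivAt.exp ((HasDerivAt.neg (HasDerivAt.fun_sum fun u _ => ?_)).div_const 2)
    refine HasDerivAt.log ?_ (hpos t u).ne'
    have h1 : HasDerivAt (fun t => p t u) (r u - q u) t := by
      have h := ((hasDerivAt_id t).mul_const (r u - q u)).const_add (q u)
      rwa [one_mul] at h
    simpa using ((h1.pow 2).const_mul lam).const_add 1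
  have hbound (t : ℝ) :
      ‖g t * (-(∑ u ∈ s, lam * (2 * p t u * (r u - q u)) / (1 + lam * p t u ^ 2)) / 2)‖
        ≤ K * B := by
    have hsum : |-(∑ u ∈ s, lam * (2 * p t u * (r u - q u)) / (1 + lam * p t u ^ 2)) / 2|
        ≤ (∑ u ∈ s, lam * |p t u| / (1 + lam * p t u ^ 2)) * B := by
      rw [neg_div, abs_neg, Finset.sum_div, Finset.sum_mul]
      refine (Finset.abs_sum_le_sum_abs _ _).trans (Finset.sum_le_sum fun u _ => ?_)
      have h1 : lam * (2 * p t u * (r u - q u)) / (1 + lam * p t u ^ 2) / 2 =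
          lam * p t u / (1 + lam * p t u ^ 2) * (r u - q u) := by ring
      rw [h1, abs_mul, abs_div, abs_mul, abs_of_pos hlam, abs_of_pos (hpos t u)]
      exact mul_le_mul_of_nonneg_left (hB u)
        (div_nonneg (mul_nonneg hlam.le (abs_nonneg _)) (hpos t u).le)
    rw [Real.norm_eq_abs, abs_mul, abs_of_pos (Real.exp_pos _)]
    refine (mul_le_mul_of_nonneg_left hsum (Real.exp_pos _).le).trans ?_
    rw [← mul_assoc]
    exact mul_le_mul_of_nonneg_right
      (exp_neg_half_sum_log_mul_sum_le s (p t) hlam hK hs hd) hB0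
  have h := norm_image_sub_le_of_norm_deriv_le_segment_01' (f := g) (C := K * B)
    (fun t _ => (hder t).hasDerivWithinAt) (fun t _ => hbound t)
  simpa [hg, hp] using h

lemma lambdaC_pos {D : ℕ} (hD : 3 ≤ D) : 0 < lambdaC D := by
  have h : (3 : ℝ) ≤ D := by exact_mod_cast hD
  exact div_pos (pow_pos (by linarith) _) (pow_pos (by linarith) _)

lemma lambdaC_mul_le {D : ℕ} (hD : 3 ≤ D) :
    lambdaC D * ((D : ℝ) - 1) ≤ Real.exp 1 * Real.exp (2 / ((D : ℝ) - 2)) := by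
  have h : (3 : ℝ) ≤ D := by exact_mod_cast hD
  have h2 : 0 < (D : ℝ) - 2 := by linarith
  have h1 : lambdaC D * ((D : ℝ) - 1) = (1 / ((D : ℝ) - 2) + 1) ^ D := by
    rw [lambdaC, div_mul_eq_mul_div, ← pow_succ, Nat.sub_add_cancel (by omega), ← div_pow]
    congr 1
    field_simp
    ring
  rw [h1, ← Real.exp_add]
  calc (1 / ((D : ℝ) - 2) + 1) ^ D ≤ (Real.exp (1 / ((D : ℝ) - 2))) ^ D :=
        pow_le_pow_left₀ (by positivity) (Real.add_one_le_exp _) _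
    _ = Real.exp (1 + 2 / ((D : ℝ) - 2)) := by
        rw [← Real.exp_nat_mul]
        congr 1
        field_simp
        ring

lemma exists_forall_mul_le_exp_one_mul {δ : ℝ} (hδ : 0 < δ) :
    ∃ D₀ : ℕ, ∀ (D : ℕ) (lam : ℝ), D₀ ≤ D → 0 < lam → lam < (1 - δ) * lambdaC D →
      δ < 1 ∧ lam * ((D : ℝ) - 1) ≤ Real.exp 1 * (1 - δ / 6) ^ 2 := by
  have hlim : Filter.Tendsto (fun n : ℕ => Real.exp (2 / ((n : ℝ) - 2))) Filter.atTop
      (nhds 1) := by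
    have h : Filter.Tendsto (fun n : ℕ => 2 / ((n : ℝ) - 2)) Filter.atTop (nhds 0) :=
      Filter.Tendsto.const_div_atTop
        (Filter.tendsto_atTop_add_const_right _ (-2) tendsto_natCast_atTop_atTop) 2
    have h' := (Real.continuous_exp.tendsto 0).comp h
    rwa [Real.exp_zero] at h'
  obtain ⟨N, hN⟩ := Filter.eventually_atTop.1
    (hlim.eventually_le_const (show (1 : ℝ) < 1 + δ / 2 by linarith))
  refine ⟨max N 3, fun D lam hD hlam hlt => ?_⟩
  have hD3 : 3 ≤ D := (le_max_right _ _).trans hD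
  have hc := lambdaC_pos hD3
  have hδ1 : δ < 1 := by
    by_contra! hge
    nlinarith
  refine ⟨hδ1, ?_⟩
  have h3 : (3 : ℝ) ≤ D := by exact_mod_cast hD3
  have he := hN D ((le_max_left _ _).trans hD)
  calc lam * ((D : ℝ) - 1) ≤ (1 - δ) * lambdaC D * ((D : ℝ) - 1) :=
        mul_le_mul_of_nonneg_right hlt.le (by linarith)
    _ = (1 - δ) * (lambdaC D * ((D : ℝ) - 1)) := by ring
    _ ≤ (1 - δ) * (Real.exp 1 * (1 + δ / 2)) := by
        refine mul_le_mul_of_nonneg_left ((lambdaC_mul_le hD3).trans ?_) (by linarith)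
        exact mul_le_mul_of_nonneg_left he (Real.exp_pos _).le
    _ = Real.exp 1 * ((1 - δ) * (1 + δ / 2)) := by ring
    _ ≤ Real.exp 1 * (1 - δ / 6) ^ 2 :=
        mul_le_mul_of_nonneg_left (by nlinarith) (Real.exp_pos _).le

section SqrtCoordinates

variable {V : Type} [Fintype V] [DecidableEq V] (G : SimpleGraph V) [DecidableRel G.Adj]

/-- The operator `bpH` in the coordinates `r = √ω`. -/
def bpSqrt (lam : ℝ) (r : DEdge G → ℝ) : DEdge G → ℝ :=
  fun e => √(bpH G lam (fun a => r a ^ 2) e)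

variable {G}

lemma bpH_mem_Icc {lam : ℝ} (hlam : 0 < lam) {ω : DEdge G → ℝ} (hω : ∀ e, 0 ≤ ω e)
    (e : DEdge G) : bpH G lam ω e ∈ Set.Icc (0 : ℝ) 1 := by
  have h (a : DEdge G) : 1 ≤ 1 + lam * ω a := by
    have := mul_nonneg hlam.le (hω a)
    linarith
  exact ⟨Finset.prod_nonneg fun u _ => inv_nonneg.2 (zero_le_one.trans (h _)),
    Finset.prod_le_one (fun u _ => inv_nonneg.2 (zero_le_one.trans (h _)))
      fun u _ => inv_le_one_of_one_le₀ (h _)⟩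

lemma bpSqrt_sqrt (lam : ℝ) {ω : DEdge G → ℝ} (hω : ∀ e, 0 ≤ ω e) :
    bpSqrt G lam (fun a => √(ω a)) = fun e => √(bpH G lam ω e) := by
  have h : (fun a => √(ω a) ^ 2) = ω := funext fun a => Real.sq_sqrt (hω a)
  unfold bpSqrt
  rw [h]

lemma bpH_iterate_nonneg {lam : ℝ} (hlam : 0 < lam) {ω : DEdge G → ℝ} (hω : ∀ e, 0 ≤ ω e)
    (i : ℕ) (e : DEdge G) : 0 ≤ (bpH G lam)^[i] ω e := by
  induction i generalizing e with
  | zero => exact hω e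
  | succ i ih =>
    rw [Function.iterate_succ_apply']
    exact (bpH_mem_Icc hlam ih e).1

lemma bpSqrt_iterate_sqrt {lam : ℝ} (hlam : 0 < lam) {ω : DEdge G → ℝ} (hω : ∀ e, 0 ≤ ω e)
    (i : ℕ) : (bpSqrt G lam)^[i] (fun a => √(ω a)) = fun e => √((bpH G lam)^[i] ω e) := by
  induction i with
  | zero => rfl
  | succ i ih =>
    rw [Function.iterate_succ_apply', ih, bpSqrt_sqrt lam (bpH_iterate_nonneg hlam hω i),
      Function.iterate_succ_apply']

lemma contractingWith_bpSqrt {lam : ℝ} {K : NNReal} (hlam : 0 < lam) (hK : K < 1)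
    (hd : lam * ((G.maxDegree : ℝ) - 1) ≤ Real.exp 1 * (K : ℝ) ^ 2) :
    ContractingWith K (bpSqrt G lam) := by
  refine ⟨hK, LipschitzWith.of_dist_le_mul fun r q => ?_⟩
  refine (dist_pi_le_iff (by positivity)).2 fun e => ?_
  rw [Real.dist_eq]
  refine abs_sqrt_prod_inv_sub_le ((G.neighborFinset e.1.1).erase e.1.2).attach
    (fun u => q ⟨(u.1, e.1.1), _⟩) (fun u => r ⟨(u.1, e.1.1), _⟩)
    hlam K.2 ?_ hd dist_nonneg fun u => ?_
  · have hmem : e.1.2 ∈ G.neighborFinset e.1.1 := (G.mem_neighborFinset _ _).2 e.2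
    have hpos : 1 ≤ (G.neighborFinset e.1.1).card := Finset.card_pos.2 ⟨_, hmem⟩
    rw [Finset.card_attach, Finset.card_erase_of_mem hmem, Nat.cast_sub hpos, Nat.cast_one]
    have hle : ((G.neighborFinset e.1.1).card : ℝ) ≤ G.maxDegree := by
      exact_mod_cast (G.card_neighborFinset_eq_degree e.1.1).trans_le (G.degree_le_maxDegree _)
    linarith
  · rw [← Real.dist_eq]
    exact dist_le_pi_dist r q _

end SqrtCoordinates

theorem bpH_unique_fixed_point_and_convergence :
    ∀ δ : ℝ, 0 < δ →
    ∃ Δ₀ : ℕ,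
      ∀ (V : Type) [Fintype V] [DecidableEq V] (G : SimpleGraph V) [DecidableRel G.Adj]
        (Δ : ℕ) (lam : ℝ),
        G.maxDegree = Δ → Δ₀ ≤ Δ →
        0 < lam → lam < (1 - δ) * lambdaC Δ →
        ∃ ωstar : DEdge G → ℝ,
          ((∀ e, ωstar e ∈ Set.Icc (0 : ℝ) 1) ∧ bpH G lam ωstar = ωstar) ∧
          (∀ ω' : DEdge G → ℝ,
            ((∀ e, ω' e ∈ Set.Icc (0 : ℝ) 1) ∧ bpH G lam ω' = ω') → ω' = ωstar) ∧
          (∀ ω0 : DEdge G → ℝ, (∀ e, ω0 e ∈ Set.Icc (0 : ℝ) 1) →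
            ∀ (i : ℕ) (e : DEdge G),
              |((bpH G lam)^[i] ω0) e - ωstar e| ≤ 3 * (1 - δ / 6) ^ i) := by
  intro δ hδ
  obtain ⟨D₀, hD₀⟩ := exists_forall_mul_le_exp_one_mul hδ
  refine ⟨D₀, fun V _ _ G _ Δ lam hΔ hD hlam hlt => ?_⟩
  obtain ⟨hδ1, hle⟩ := hD₀ Δ lam hD hlam hlt
  set K : NNReal := ⟨1 - δ / 6, by linarith⟩ with hKdef
  have hK : K < 1 := by
    rw [← NNReal.coe_lt_coe]
    change 1 - δ / 6 < 1
    linarith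
  have hF : ContractingWith K (bpSqrt G lam) :=
    contractingWith_bpSqrt hlam hK (by rw [hΔ]; exact hle)
  set r := ContractingWith.fixedPoint (bpSqrt G lam) hF with hr
  have hfix : bpSqrt G lam r = r := hF.fixedPoint_isFixedPt
  have hfix' (e : DEdge G) : √(bpH G lam (fun a => r a ^ 2) e) = r e := congrFun hfix e
  have hH (e : DEdge G) := bpH_mem_Icc hlam (ω := fun a => r a ^ 2) (fun a => sq_nonneg _) e
  have hr0 (e : DEdge G) : 0 ≤ r e := by
    rw [← hfix' e]
    exact Real.sqrt_nonneg _
  have hr1 (e : DEdge G) : r e ≤ 1 := by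
    rw [← hfix' e]
    exact Real.sqrt_le_one.2 (hH e).2
  refine ⟨fun e => r e ^ 2, ⟨fun e => ⟨sq_nonneg _, pow_le_one₀ (hr0 e) (hr1 e)⟩, ?_⟩, ?_, ?_⟩
  · funext e
    rw [← Real.sq_sqrt (hH e).1, hfix' e]
  · rintro ω ⟨hω, hωfix⟩
    have h : bpSqrt G lam (fun a => √(ω a)) = fun a => √(ω a) := by
      rw [bpSqrt_sqrt lam fun e => (hω e).1, hωfix]
    have h' : (fun a => √(ω a)) = r := hF.fixedPoint_unique h
    funext e
    rw [← h', Real.sq_sqrt (hω e).1]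
  · intro ω hω i e
    have hω0 (e : DEdge G) : 0 ≤ ω e := (hω e).1
    set x := (bpH G lam)^[i] ω e with hx
    have hx0 : 0 ≤ x := bpH_iterate_nonneg hlam hω0 i e
    have hx1 : x ≤ 1 := by
      cases i with
      | zero => exact (hω e).2
      | succ i =>
        rw [hx, Function.iterate_succ_apply']
        exact (bpH_mem_Icc hlam (bpH_iterate_nonneg hlam hω0 i) e).2
    have hinit : dist (fun a => √(ω a)) r ≤ 1 := by
      refine (dist_pi_le_iff zero_le_one).2 fun a => ?_
      rw [Real.dist_eq, abs_le]
      have h1 := Real.sqrt_nonneg (ω a)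
      have h2 : √(ω a) ≤ 1 := Real.sqrt_le_one.2 (hω a).2
      constructor <;> linarith [hr0 a, hr1 a]
    have hdist : |√x - r e| ≤ (1 - δ / 6) ^ i := by
      have h1 := (hF.toLipschitzWith.iterate i).dist_le_mul (fun a => √(ω a)) r
      rw [bpSqrt_iterate_sqrt hlam hω0, Function.iterate_fixed hfix] at h1
      have h2 := (dist_le_pi_dist (fun a => √((bpH G lam)^[i] ω a)) r e).trans h1
      rw [Real.dist_eq, NNReal.coe_pow] at h2
      exact h2.trans (mul_le_of_le_one_right (by positivity) hinit)
    have hsum : |√x + r e| ≤ 2 := by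
      rw [abs_of_nonneg (add_nonneg (Real.sqrt_nonneg _) (hr0 e))]
      linarith [hr1 e, Real.sqrt_le_one.2 hx1]
    have hpow : 0 ≤ (1 - δ / 6) ^ i := (abs_nonneg _).trans hdist
    calc |x - r e ^ 2| = |√x + r e| * |√x - r e| := by
          rw [← abs_mul, ← sq_sub_sq, Real.sq_sqrt hx0]
      _ ≤ 2 * (1 - δ / 6) ^ i := mul_le_mul hsum hdist (abs_nonneg _) zero_le_two
      _ ≤ 3 * (1 - δ / 6) ^ i := by linarith
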